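/- Let V be a distribution on the unit disk D ⊂ ℝ² with ∇V = A + B, where A ∈ H^{−1}(D, ℝ²) and B ∈ L¹(D, ℝ²). Then for every r < 1 there exists a constant c ∈ ℝ and C(r) > 0 (depending only on r) such that ‖V − c‖_{L^{2,∞}(D_r)} ≤ C(r)(‖A‖_{H^{−1}(D)} + ‖B‖_{L¹(D)}). -/

import Mathlib

open Real MeasureTheory

/-- The weak-L² (L^{2,∞}) quasinorm of a function on a subset of ℝ²,
    via the distribution function: sup_{t>0} t · vol{x ∈ s : |f x| > t}^{1/2}. -/
noncomputable def wnorm2 (f : ℝ × ℝ → ℝ) (s : Set (ℝ × ℝ)) : ENNReal :=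
  ⨆ t : {t : ℝ // 0 < t}, ENNReal.ofReal t.1 *
    (MeasureTheory.volume {x : ℝ × ℝ | x ∈ s ∧ (t.1 : ℝ) < |f x|}) ^ (1 / 2 : ℝ)

/-- A smooth test vector field compactly supported in the unit disk. -/
def IsTestField (φ : ℝ × ℝ → ℝ × ℝ) : Prop :=
  ContDiff ℝ (⊤ : ℕ∞) φ ∧ HasCompactSupport φ ∧
    tsupport φ ⊆ Metric.ball (0 : ℝ × ℝ) 1

/-- The divergence of a vector field on ℝ². -/
noncomputable def divg (φ : ℝ × ℝ → ℝ × ℝ) (x : ℝ × ℝ) : ℝ :=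
  (fderiv ℝ φ x (1, 0)).1 + (fderiv ℝ φ x (0, 1)).2

/-- The H¹₀-norm (Dirichlet norm) of a test vector field. -/
noncomputable def h10norm (φ : ℝ × ℝ → ℝ × ℝ) : ℝ :=
  Real.sqrt (∫ x, ‖fderiv ℝ φ x (1, 0)‖ ^ 2 + ‖fderiv ℝ φ x (0, 1)‖ ^ 2)


namespace Aux18

abbrev E2 := ℝ × ℝ

/-- `T(s-1)/s`. -/
noncomputable def J (s : ℝ) : ℝ := Real.smoothTransition (s - 1) / s

lemma J_mul (s : ℝ) : s * J s = Real.smoothTransition (s - 1) := by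
  by_cases h : s = 0
  · subst h
    rw [Real.smoothTransition.zero_of_nonpos (by norm_num)]; simp
  · unfold J; field_simp

lemma J_contDiff : ContDiff ℝ (⊤ : ℕ∞) J := by
  rw [contDiff_iff_contDiffAt]
  intro s
  by_cases h : s = 0
  · have : J =ᶠ[nhds s] fun _ => 0 := by
      have h1 : Set.Iio (1:ℝ) ∈ nhds s := Iio_mem_nhds (by rw [h]; norm_num)
      filter_upwards [h1] with t ht
      unfold J
      rw [Real.smoothTransition.zero_of_nonpos (by linarith [Set.mem_Iio.1 ht])]; simp
    exact contDiffAt_const.congr_of_eventuallyEq this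
  · unfold J
    exact (Real.smoothTransition.contDiff.comp (contDiff_id.sub contDiff_const)).contDiffAt.div
      contDiffAt_id h

lemma J_deriv (s : ℝ) : J s + s * deriv J s = deriv Real.smoothTransition (s - 1) := by
  have hJ : HasDerivAt J (deriv J s) s :=
    ((J_contDiff.differentiable (by simp)) s).hasDerivAt
  have h1 : HasDerivAt (fun s => s * J s) (1 * J s + s * deriv J s) s := (hasDerivAt_id s).mul hJ
  have hT : HasDerivAt Real.smoothTransition (deriv Real.smoothTransition (s - 1)) (s - 1) :=
    (((Real.smoothTransition.contDiff (n := 1)).differentiable (by simp)) _).hasDerivAt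
  have h2 : HasDerivAt (fun s => Real.smoothTransition (s - 1))
      (deriv Real.smoothTransition (s - 1)) s := by
    exact (hT.comp s ((hasDerivAt_id s).sub_const 1)).congr_deriv (mul_one _)
  rw [funext J_mul] at h1
  have := h1.unique h2
  linarith

noncomputable def sq (x : E2) : ℝ := x.1 ^ 2 + x.2 ^ 2

lemma sq_contDiff : ContDiff ℝ (⊤ : ℕ∞) sq := by unfold sq; fun_prop

lemma norm_sq_le (x : E2) : ‖x‖ ^ 2 ≤ sq x := by
  unfold sq
  rw [Prod.norm_def]
  rcases max_cases ‖x.1‖ ‖x.2‖ with h | h <;> rw [h.1] <;> simp only [Real.norm_eq_abs, sq_abs] <;>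
    nlinarith [sq_nonneg x.1, sq_nonneg x.2]

noncomputable def F (e : ℝ) (x : E2) : ℝ := J (sq x / e) / e

noncomputable def P (e : ℝ) (x : E2) : ℝ := 2 / e * deriv Real.smoothTransition (sq x / e - 1)

lemma F_contDiff (e : ℝ) : ContDiff ℝ (⊤ : ℕ∞) (F e) := by
  unfold F
  exact (J_contDiff.comp (sq_contDiff.div_const e)).div_const e

lemma P_contDiff (e : ℝ) : ContDiff ℝ (⊤ : ℕ∞) (P e) := by
  unfold P
  have hd : ContDiff ℝ (⊤ : ℕ∞) (deriv Real.smoothTransition) := by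
    have := (Real.smoothTransition.contDiff (n := ⊤))
    exact (contDiff_infty_iff_deriv.1 this).2
  exact contDiff_const.mul (hd.comp ((sq_contDiff.div_const e).sub contDiff_const))

lemma P_nonneg {e : ℝ} (he : 0 < e) (x : E2) : 0 ≤ P e x := by
  unfold P
  have : 0 ≤ deriv Real.smoothTransition (sq x / e - 1) :=
    Real.smoothTransition.monotone.deriv_nonneg
  positivity

lemma deriv_T_zero {s : ℝ} (h : 1 < s) : deriv Real.smoothTransition s = 0 := by
  have : Real.smoothTransition =ᶠ[nhds s] fun _ => 1 := by
    filter_upwards [Ioi_mem_nhds h] with t ht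
    exact Real.smoothTransition.one_of_one_le (le_of_lt ht)
  rw [this.deriv_eq]; simp

lemma P_zero {e R : ℝ} (he : 0 < e) (hR : 2 * e ≤ R ^ 2) (hR0 : 0 ≤ R) {x : E2} (hx : R < ‖x‖) :
    P e x = 0 := by
  unfold P
  rw [deriv_T_zero, mul_zero]
  have h1 := norm_sq_le x
  have : R ^ 2 < ‖x‖ ^ 2 := by nlinarith
  rw [lt_sub_iff_add_lt, lt_div_iff₀ he]; linarith

lemma F_hasFDeriv {e : ℝ} (x : E2) : HasFDerivAt (F e)
    ((2 / e ^ 2 * deriv J (sq x / e)) • (x.1 • ContinuousLinearMap.fst ℝ ℝ ℝ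
      + x.2 • ContinuousLinearMap.snd ℝ ℝ ℝ)) x := by
  have hJ : HasDerivAt J (deriv J (sq x / e)) (sq x / e) :=
    ((J_contDiff.differentiable (by simp)) _).hasDerivAt
  have h1 : HasFDerivAt (fun x : E2 => x.1) (ContinuousLinearMap.fst ℝ ℝ ℝ) x := hasFDerivAt_fst
  have h2 : HasFDerivAt (fun x : E2 => x.2) (ContinuousLinearMap.snd ℝ ℝ ℝ) x := hasFDerivAt_snd
  have hs : HasFDerivAt (fun x => sq x * e⁻¹) (e⁻¹ • ((2 * x.1) • ContinuousLinearMap.fst ℝ ℝ ℝ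
      + (2 * x.2) • ContinuousLinearMap.snd ℝ ℝ ℝ)) x := by
    have := ((h1.pow 2).add (h2.pow 2)).mul_const e⁻¹
    exact this.congr_fderiv (by ext <;> simp)
  have := (hJ.comp_hasFDerivAt x (f := fun x => sq x / e) (by simpa only [div_eq_mul_inv] using hs)).mul_const e⁻¹
  unfold F
  simp only [div_eq_mul_inv (J _)]
  exact this.congr_fderiv (by ext <;> simp <;> field_simp)

noncomputable def k1 (e a : ℝ) (x : E2) : ℝ := x.1 * (F e x - F a x)
noncomputable def k2 (e a : ℝ) (x : E2) : ℝ := x.2 * (F e x - F a x)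

lemma k1_contDiff (e a : ℝ) : ContDiff ℝ (⊤ : ℕ∞) (k1 e a) :=
  contDiff_fst.mul ((F_contDiff e).sub (F_contDiff a))
lemma k2_contDiff (e a : ℝ) : ContDiff ℝ (⊤ : ℕ∞) (k2 e a) :=
  contDiff_snd.mul ((F_contDiff e).sub (F_contDiff a))

lemma k1_fderiv (e a : ℝ) (x : E2) : HasFDerivAt (k1 e a)
    (x.1 • ((2 / e ^ 2 * deriv J (sq x / e)) • (x.1 • ContinuousLinearMap.fst ℝ ℝ ℝ
      + x.2 • ContinuousLinearMap.snd ℝ ℝ ℝ) - (2 / a ^ 2 * deriv J (sq x / a)) •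
      (x.1 • ContinuousLinearMap.fst ℝ ℝ ℝ
      + x.2 • ContinuousLinearMap.snd ℝ ℝ ℝ)) +
      (F e x - F a x) • ContinuousLinearMap.fst ℝ ℝ ℝ) x := by
  have h1 : HasFDerivAt (fun x : E2 => x.1) (ContinuousLinearMap.fst ℝ ℝ ℝ) x := hasFDerivAt_fst
  exact h1.mul ((F_hasFDeriv x).sub (F_hasFDeriv x))

lemma k2_fderiv (e a : ℝ) (x : E2) : HasFDerivAt (k2 e a)
    (x.2 • ((2 / e ^ 2 * deriv J (sq x / e)) • (x.1 • ContinuousLinearMap.fst ℝ ℝ ℝ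
      + x.2 • ContinuousLinearMap.snd ℝ ℝ ℝ) - (2 / a ^ 2 * deriv J (sq x / a)) •
      (x.1 • ContinuousLinearMap.fst ℝ ℝ ℝ
      + x.2 • ContinuousLinearMap.snd ℝ ℝ ℝ)) +
      (F e x - F a x) • ContinuousLinearMap.snd ℝ ℝ ℝ) x := by
  have h1 : HasFDerivAt (fun x : E2 => x.2) (ContinuousLinearMap.snd ℝ ℝ ℝ) x := hasFDerivAt_snd
  exact h1.mul ((F_hasFDeriv x).sub (F_hasFDeriv x))

lemma k_curl (e a : ℝ) (x : E2) :
    fderiv ℝ (k1 e a) x (0, 1) = fderiv ℝ (k2 e a) x (1, 0) := by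
  rw [(k1_fderiv e a x).fderiv, (k2_fderiv e a x).fderiv]
  simp; ring

lemma F_P {e : ℝ} (he : 0 < e) (x : E2) :
    2 * F e x + sq x * (2 / e ^ 2 * deriv J (sq x / e)) = P e x := by
  unfold F P
  rw [← J_deriv]; field_simp

lemma k_div {e a : ℝ} (he : 0 < e) (ha : 0 < a) (x : E2) :
    fderiv ℝ (k1 e a) x (1, 0) + fderiv ℝ (k2 e a) x (0, 1) = P e x - P a x := by
  rw [(k1_fderiv e a x).fderiv, (k2_fderiv e a x).fderiv, ← F_P he, ← F_P ha]
  simp; unfold sq; ring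

lemma F_abs {e a : ℝ} (he : 0 < e) (ha : 0 < a) (x : E2) :
    sq x * |F e x - F a x| ≤ 1 := by
  have h0 : 0 ≤ sq x := by unfold sq; positivity
  rw [← abs_of_nonneg h0, ← abs_mul]
  have : ∀ e, 0 < e → sq x * F e x = Real.smoothTransition (sq x / e - 1) := by
    intro e he
    rw [← J_mul]; unfold F; field_simp
  rw [mul_sub, this e he, this a ha]
  have b1 := Real.smoothTransition.nonneg (sq x / e - 1)
  have b2 := Real.smoothTransition.nonneg (sq x / a - 1)
  have b3 := Real.smoothTransition.le_one (sq x / e - 1)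
  have b4 := Real.smoothTransition.le_one (sq x / a - 1)
  rw [abs_le]; constructor <;> linarith

lemma k_abs_aux {u : ℝ} {x : E2} (hu : |u| ≤ ‖x‖) {v : ℝ} (hv : sq x * |v| ≤ 1) :
    |u * v| ≤ ‖x‖⁻¹ := by
  by_cases h : ‖x‖ = 0
  · have : u = 0 := by rw [h] at hu; exact abs_nonpos_iff.1 hu
    rw [this]; simp
  · have hp : 0 < ‖x‖ := lt_of_le_of_ne (norm_nonneg _) (Ne.symm h)
    have h1 := norm_sq_le x
    have h2 : ‖x‖ * (|u| * |v|) ≤ 1 := by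
      calc ‖x‖ * (|u| * |v|) ≤ ‖x‖ * (‖x‖ * |v|) := by gcongr
        _ = ‖x‖ ^ 2 * |v| := by ring
        _ ≤ sq x * |v| := by gcongr
        _ ≤ 1 := hv
    rw [abs_mul, ← one_div, le_div_iff₀ hp]; linarith

lemma k1_abs {e a : ℝ} (he : 0 < e) (ha : 0 < a) (x : E2) : |k1 e a x| ≤ ‖x‖⁻¹ :=
  k_abs_aux (norm_fst_le x) (F_abs he ha x)
lemma k2_abs {e a : ℝ} (he : 0 < e) (ha : 0 < a) (x : E2) : |k2 e a x| ≤ ‖x‖⁻¹ :=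
  k_abs_aux (norm_snd_le x) (F_abs he ha x)

lemma F_eq {e a R : ℝ} (he : 0 < e) (ha : 0 < a) (hea : e ≤ a) (hR : 2 * a ≤ R ^ 2) (hR0 : 0 ≤ R)
    {x : E2} (hx : R < ‖x‖) : F e x - F a x = 0 := by
  have h1 := norm_sq_le x
  have h2 : R ^ 2 < ‖x‖ ^ 2 := by nlinarith
  have hs : 0 < sq x := by nlinarith
  have : ∀ e, 0 < e → e ≤ a → F e x = 1 / sq x := by
    intro e he hea
    have : sq x * F e x = 1 := by
      have : sq x * F e x = Real.smoothTransition (sq x / e - 1) := by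
        rw [← J_mul]; unfold F; field_simp
      rw [this]
      apply Real.smoothTransition.one_of_one_le
      rw [le_sub_iff_add_le, le_div_iff₀ he]; linarith
    field_simp; linarith
  rw [this e he hea, this a ha le_rfl, sub_self]

lemma k1_zero {e a R : ℝ} (he : 0 < e) (ha : 0 < a) (hea : e ≤ a) (hR : 2 * a ≤ R ^ 2)
    (hR0 : 0 ≤ R) {x : E2} (hx : R < ‖x‖) : k1 e a x = 0 := by
  unfold k1; rw [F_eq he ha hea hR hR0 hx, mul_zero]
lemma k2_zero {e a R : ℝ} (he : 0 < e) (ha : 0 < a) (hea : e ≤ a) (hR : 2 * a ≤ R ^ 2)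
    (hR0 : 0 ≤ R) {x : E2} (hx : R < ‖x‖) : k2 e a x = 0 := by
  unfold k2; rw [F_eq he ha hea hR hR0 hx, mul_zero]

lemma hcs {f : E2 → ℝ} {R : ℝ} (h : ∀ x, R < ‖x‖ → f x = 0) : HasCompactSupport f :=
  HasCompactSupport.intro (isCompact_closedBall (0 : E2) R) (fun x hx => h x (by simpa using hx))

/-- Convolution of scalar functions. -/
noncomputable def cv (f k : E2 → ℝ) (x : E2) : ℝ := ∫ t, f t * k (x - t)

lemma cv_eq (f k : E2 → ℝ) : cv f k = convolution f k (ContinuousLinearMap.mul ℝ ℝ) volume := rfl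

lemma cv_contDiff {f k : E2 → ℝ} (hf : Integrable f) (hk : ContDiff ℝ (⊤ : ℕ∞) k)
    (hc : HasCompactSupport k) : ContDiff ℝ (⊤ : ℕ∞) (cv f k) := by
  rw [cv_eq]
  exact hc.contDiff_convolution_right _ hf.locallyIntegrable hk

lemma cv_fderiv {f k : E2 → ℝ} (hf : Integrable f) (hk : ContDiff ℝ (⊤ : ℕ∞) k)
    (hc : HasCompactSupport k) (x v : E2) :
    fderiv ℝ (cv f k) x v = cv f (fun z => fderiv ℝ k z v) x := by
  have hk1 : ContDiff ℝ 1 k := hk.of_le (by exact_mod_cast le_top)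
  have h := hc.hasFDerivAt_convolution_right (ContinuousLinearMap.mul ℝ ℝ)
    hf.locallyIntegrable hk1 x
  rw [cv_eq, h.fderiv, convolution_precompR_apply _ hf.locallyIntegrable (hc.fderiv ℝ)
    (hk1.continuous_fderiv one_ne_zero)]
  rfl

lemma cv_int {f k : E2 → ℝ} (hf : Integrable f) (hk : Continuous k)
    (hc : HasCompactSupport k) (x : E2) : Integrable (fun t => f t * k (x - t)) := by
  obtain ⟨C, hC⟩ := hc.exists_bound_of_continuous hk
  refine hf.mul_bdd (c := C) (by fun_prop) ?_
  exact Filter.Eventually.of_forall (fun t => hC _)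

lemma cv_sub {f k k' : E2 → ℝ} (hf : Integrable f) (hk : Continuous k)
    (hc : HasCompactSupport k) (hk' : Continuous k') (hc' : HasCompactSupport k') (x : E2) :
    cv f (fun z => k z - k' z) x = cv f k x - cv f k' x := by
  unfold cv
  rw [← integral_sub (cv_int hf hk hc x) (cv_int hf hk' hc' x)]
  congr 1; ext t; ring

lemma cv_add {f k k' : E2 → ℝ} (hf : Integrable f) (hk : Continuous k)
    (hc : HasCompactSupport k) (hk' : Continuous k') (hc' : HasCompactSupport k') (x : E2) :
    cv f (fun z => k z + k' z) x = cv f k x + cv f k' x := by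
  unfold cv
  rw [← integral_add (cv_int hf hk hc x) (cv_int hf hk' hc' x)]
  congr 1; ext t; ring

lemma cd_fderiv {u : E2 → ℝ} (hu : ContDiff ℝ (⊤ : ℕ∞) u) (v : E2) :
    ContDiff ℝ (⊤ : ℕ∞) (fun x => fderiv ℝ u x v) :=
  (hu.fderiv_right (m := (⊤ : ℕ∞)) (by simp)).clm_apply contDiff_const

lemma int_cs {u : E2 → ℝ} (hu : Continuous u) (hc : HasCompactSupport u) : Integrable u :=
  hu.integrable_of_hasCompactSupport hc

lemma ibp {u w : E2 → ℝ} (hu : ContDiff ℝ (⊤ : ℕ∞) u) (hcu : HasCompactSupport u)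
    (hw : ContDiff ℝ (⊤ : ℕ∞) w) (v : E2) :
    ∫ x, u x * fderiv ℝ w x v = - ∫ x, fderiv ℝ u x v * w x := by
  have du := (cd_fderiv hu v).continuous
  have dw := (cd_fderiv hw v).continuous
  apply integral_mul_fderiv_eq_neg_fderiv_mul_of_integrable
  · exact int_cs (du.mul hw.continuous) ((hcu.fderiv_apply ℝ v).mul_right)
  · exact int_cs (hu.continuous.mul dw) hcu.mul_right
  · exact int_cs (hu.continuous.mul hw.continuous) hcu.mul_right
  · exact fun x _ => (hu.differentiable (by simp)) x
  · exact fun x _ => (hw.differentiable (by simp)) x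

lemma int_fderiv {u : E2 → ℝ} (hu : ContDiff ℝ (⊤ : ℕ∞) u) (hcu : HasCompactSupport u) (v : E2) :
    ∫ x, fderiv ℝ u x v = 0 := by
  have := ibp hu hcu (w := fun _ => 1) contDiff_const v
  simpa using this

lemma fderiv_symm {w : E2 → ℝ} (hw : ContDiff ℝ (⊤ : ℕ∞) w) (x v v' : E2) :
    fderiv ℝ (fun z => fderiv ℝ w z v) x v' = fderiv ℝ (fun z => fderiv ℝ w z v') x v := by
  have h := (hw.contDiffAt (x := x)).isSymmSndFDerivAt
    (by rw [minSmoothness_of_isRCLikeNormedField]; exact WithTop.coe_le_coe.2 (le_top : (2:ℕ∞) ≤ ⊤))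
  have hd : DifferentiableAt ℝ (fderiv ℝ w) x :=
    ((hw.fderiv_right (m := (⊤ : ℕ∞)) (by simp)).differentiable (by simp)) x
  rw [fderiv_clm_apply hd (differentiableAt_const _), fderiv_clm_apply hd (differentiableAt_const _)]
  simpa using h.eq v' v

lemma null_lag {u w : E2 → ℝ} (hu : ContDiff ℝ (⊤ : ℕ∞) u) (hcu : HasCompactSupport u)
    (hw : ContDiff ℝ (⊤ : ℕ∞) w) (v v' : E2) :
    ∫ x, fderiv ℝ u x v * fderiv ℝ w x v' = ∫ x, fderiv ℝ u x v' * fderiv ℝ w x v := by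
  have h1 := ibp hu hcu (cd_fderiv hw v') v
  have h2 := ibp hu hcu (cd_fderiv hw v) v'
  simp only [fderiv_symm hw _ v' v] at h1
  linarith

lemma prod_fderiv {u w : E2 → ℝ} (hu : ContDiff ℝ (⊤ : ℕ∞) u) (hw : ContDiff ℝ (⊤ : ℕ∞) w)
    (x v : E2) : fderiv ℝ (fun x => (u x, w x)) x v = (fderiv ℝ u x v, fderiv ℝ w x v) := by
  rw [DifferentiableAt.fderiv_prodMk ((hu.differentiable (by simp)) x)
    ((hw.differentiable (by simp)) x)]
  rfl

lemma norm_pair_sq (a b : ℝ) : ‖((a, b) : ℝ × ℝ)‖ ^ 2 ≤ a ^ 2 + b ^ 2 := norm_sq_le (a, b)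

/-- Gradient bounded by divergence for compactly supported curl-free fields. -/
lemma h10_le {u w : E2 → ℝ} (hu : ContDiff ℝ (⊤ : ℕ∞) u) (hcu : HasCompactSupport u)
    (hw : ContDiff ℝ (⊤ : ℕ∞) w) (hcw : HasCompactSupport w)
    (hcurl : ∀ x, fderiv ℝ u x (0, 1) = fderiv ℝ w x (1, 0)) :
    h10norm (fun x => (u x, w x)) ≤
      Real.sqrt (∫ x, (fderiv ℝ u x (1, 0) + fderiv ℝ w x (0, 1)) ^ 2) := by
  unfold h10norm
  apply Real.sqrt_le_sqrt
  have c1 := (cd_fderiv hu (1, 0)).continuous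
  have c2 := (cd_fderiv hu (0, 1)).continuous
  have c3 := (cd_fderiv hw (1, 0)).continuous
  have c4 := (cd_fderiv hw (0, 1)).continuous
  have s1 := hcu.fderiv_apply ℝ (1, 0)
  have s2 := hcu.fderiv_apply ℝ (0, 1)
  have s3 := hcw.fderiv_apply ℝ (1, 0)
  have s4 := hcw.fderiv_apply ℝ (0, 1)
  have hnl := null_lag hu hcu hw (1, 0) (0, 1)
  have i14 : Integrable (fun x => fderiv ℝ u x (1, 0) * fderiv ℝ w x (0, 1)) :=
    int_cs (c1.mul c4) s1.mul_right
  have i23 : Integrable (fun x => fderiv ℝ u x (0, 1) * fderiv ℝ w x (1, 0)) :=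
    int_cs (c2.mul c3) s2.mul_right
  have sqi : ∀ {f : E2 → ℝ}, Continuous f → HasCompactSupport f → Integrable (fun x => f x ^ 2) := by
    intro f hf hc
    simp only [pow_two]
    exact int_cs (hf.mul hf) hc.mul_right
  have idiv := sqi (c1.add c4) (s1.add s4)
  have e1 : ∫ x, (fderiv ℝ u x (1, 0) + fderiv ℝ w x (0, 1)) ^ 2 =
      ∫ x, ((fderiv ℝ u x (1, 0) ^ 2 + fderiv ℝ w x (1, 0) ^ 2) +
        (fderiv ℝ u x (0, 1) ^ 2 + fderiv ℝ w x (0, 1) ^ 2)) := by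
    have : ∫ x, 2 * (fderiv ℝ u x (1, 0) * fderiv ℝ w x (0, 1)
        - fderiv ℝ u x (0, 1) * fderiv ℝ w x (1, 0)) = 0 := by
      rw [integral_const_mul, integral_sub i14 i23, hnl]; simp
    rw [← sub_eq_zero, ← integral_sub]
    · refine Eq.trans ?_ this
      congr 1; ext x; rw [hcurl x]; ring
    · exact idiv
    · exact ((sqi c1 s1).add (sqi c3 s3)).add ((sqi c2 s2).add (sqi c4 s4))
  rw [e1]
  apply integral_mono_of_nonneg
  · exact Filter.Eventually.of_forall (fun x => by positivity)
  · exact ((sqi c1 s1).add (sqi c3 s3)).add ((sqi c2 s2).add (sqi c4 s4))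
  · refine Filter.Eventually.of_forall (fun x => ?_)
    simp only [prod_fderiv hu hw]
    exact add_le_add (norm_pair_sq _ _) (norm_pair_sq _ _)

lemma P_int {e a : ℝ} (he : 0 < e) (ha : 0 < a) (hea : e ≤ a) : ∫ x, P e x = ∫ x, P a x := by
  have hR0 : (0:ℝ) ≤ Real.sqrt (2 * a) := Real.sqrt_nonneg _
  have hR : 2 * a ≤ Real.sqrt (2 * a) ^ 2 := by rw [Real.sq_sqrt (by linarith)]
  have z1 := hcs (f := k1 e a) (fun x hx => k1_zero he ha hea hR hR0 hx)
  have z2 := hcs (f := k2 e a) (fun x hx => k2_zero he ha hea hR hR0 hx)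
  have ze := hcs (f := P e) (fun x hx => P_zero he (by linarith) hR0 hx)
  have za := hcs (f := P a) (fun x hx => P_zero ha hR hR0 hx)
  have := int_fderiv (k1_contDiff e a) z1 (1, 0)
  have h2 := int_fderiv (k2_contDiff e a) z2 (0, 1)
  rw [← sub_eq_zero, ← integral_sub (int_cs (P_contDiff e).continuous ze)
    (int_cs (P_contDiff a).continuous za)]
  simp only [← k_div he ha]
  rw [integral_add, this, h2, add_zero]
  · exact int_cs (cd_fderiv (k1_contDiff e a) _).continuous (z1.fderiv_apply ℝ _)
  · exact int_cs (cd_fderiv (k2_contDiff e a) _).continuous (z2.fderiv_apply ℝ _)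

lemma P_cs {a : ℝ} (ha : 0 < a) : HasCompactSupport (P a) :=
  hcs (R := Real.sqrt (2 * a)) (fun x hx => P_zero ha (by rw [Real.sq_sqrt (by linarith)])
    (Real.sqrt_nonneg _) hx)

lemma P_int_pos {a : ℝ} (ha : 0 < a) : 0 < ∫ x, P a x := by
  have : ∃ s ∈ Set.Ioo (0:ℝ) 1, deriv Real.smoothTransition s =
      (Real.smoothTransition 1 - Real.smoothTransition 0) / (1 - 0) :=
    exists_deriv_eq_slope _ zero_lt_one Real.smoothTransition.continuous.continuousOn
      (((Real.smoothTransition.contDiff (n := 1)).differentiable (by simp)).differentiableOn)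
  obtain ⟨s, hs, h⟩ := this
  rw [Real.smoothTransition.one, Real.smoothTransition.zero] at h
  apply (P_contDiff a).continuous.integral_pos_of_hasCompactSupport_nonneg_nonzero
    (x := (Real.sqrt (a * (s + 1)), 0)) (P_cs ha) (fun x => P_nonneg ha x)
  unfold P sq
  have h0 : 0 ≤ a * (s + 1) := by have := hs.1; positivity
  simp only [Real.sq_sqrt h0]
  have : (a * (s + 1) + 0 ^ 2) / a - 1 = s := by field_simp; ring
  rw [this, h]
  simp [ha.ne']

lemma sing : ∃ C0 : ℝ, 0 < C0 ∧ ∀ (S : Set E2) (M : ℝ), MeasurableSet S → 0 < M →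
    volume S ≤ ENNReal.ofReal M → ∀ x : E2, IntegrableOn (fun t => ‖x - t‖⁻¹) S ∧
      ∫ t in S, ‖x - t‖⁻¹ ≤ C0 * Real.sqrt M := by
  set b : ℝ := (volume : Measure E2).real (Metric.ball 0 1) with hb
  refine ⟨2 * b + 1, by positivity, ?_⟩
  intro S M hS hM hSM x
  set ρ := Real.sqrt M with hρ
  have hρ0 : 0 < ρ := Real.sqrt_pos.2 hM
  set f : ℝ → ℝ := (Set.Iio ρ).indicator (fun s => s⁻¹) with hf
  have hfr : Module.finrank ℝ E2 = 2 := by simp [E2]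
  have hf1 : ∀ y ∈ Set.Ioi (0:ℝ), y ^ (Module.finrank ℝ E2 - 1) • f y =
      (Set.Iio ρ).indicator (fun _ => (1:ℝ)) y := by
    intro y hy
    have : y ≠ 0 := ne_of_gt hy
    rw [hfr, hf]
    by_cases h : y ∈ Set.Iio ρ
    · simp [Set.indicator_of_mem h, this]
    · simp [Set.indicator_of_notMem h]
  have hfin : volume (Set.Iio ρ ∩ Set.Ioi (0:ℝ)) = ENNReal.ofReal ρ := by
    have : Set.Iio ρ ∩ Set.Ioi (0:ℝ) = Set.Ioo 0 ρ := by ext; simp [and_comm]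
    rw [this]; simp
  have hint : Integrable (fun y : E2 => f ‖y‖) := by
    rw [integrable_fun_norm_addHaar]
    rw [integrableOn_congr_fun hf1 measurableSet_Ioi]
    rw [IntegrableOn, integrable_indicator_iff measurableSet_Iio]
    rw [integrableOn_const_iff, Measure.restrict_apply measurableSet_Iio, hfin]
    right; exact ENNReal.ofReal_lt_top
  have hval : ∫ y : E2, f ‖y‖ = 2 * (b * ρ) := by
    rw [integral_fun_norm_addHaar, setIntegral_congr_fun measurableSet_Ioi hf1,
      integral_indicator measurableSet_Iio, hfr]
    simp only [integral_const, smul_eq_mul, nsmul_eq_mul, mul_one]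
    rw [measureReal_restrict_apply_univ, measureReal_restrict_apply measurableSet_Iio,
      measureReal_def volume (Set.Iio ρ ∩ _), hfin, ENNReal.toReal_ofReal hρ0.le]
    simp [hb]
  have hfn : ∀ s, 0 ≤ s → 0 ≤ f s := by
    intro s hs
    rw [hf]; exact Set.indicator_apply_nonneg (fun _ => inv_nonneg.2 hs)
  have hint' : Integrable (fun t : E2 => f ‖x - t‖) := hint.comp_sub_left x
  have hSfin : volume S < ⊤ := lt_of_le_of_lt hSM ENNReal.ofReal_lt_top
  have hle : ∀ t : E2, ‖x - t‖⁻¹ ≤ f ‖x - t‖ + ρ⁻¹ := by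
    intro t
    by_cases h : ‖x - t‖ < ρ
    · rw [hf, Set.indicator_of_mem (by exact h)]
      have : 0 < ρ⁻¹ := by positivity
      linarith
    · have h1 := hfn ‖x - t‖ (norm_nonneg _)
      have : ‖x - t‖⁻¹ ≤ ρ⁻¹ := inv_anti₀ hρ0 (not_lt.1 h)
      linarith
  have hc : IntegrableOn (fun _ : E2 => ρ⁻¹) S := integrableOn_const hSfin.ne
  have hsum : IntegrableOn (fun t : E2 => f ‖x - t‖ + ρ⁻¹) S := hint'.integrableOn.add hc
  have hi : IntegrableOn (fun t : E2 => ‖x - t‖⁻¹) S := by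
    refine Integrable.mono' hsum (by fun_prop) (Filter.Eventually.of_forall fun t => ?_)
    rw [Real.norm_of_nonneg (by positivity)]; exact hle t
  refine ⟨hi, ?_⟩
  calc ∫ t in S, ‖x - t‖⁻¹ ≤ ∫ t in S, (f ‖x - t‖ + ρ⁻¹) := integral_mono hi hsum hle
    _ = (∫ t in S, f ‖x - t‖) + volume.real S * ρ⁻¹ := by
        rw [integral_add hint'.integrableOn hc]; simp
    _ ≤ 2 * (b * ρ) + M * ρ⁻¹ := by
        gcongr
        · rw [← hval, ← integral_sub_left_eq_self (fun y : E2 => f ‖y‖) volume x]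
          exact setIntegral_le_integral hint'
            (Filter.Eventually.of_forall fun t => hfn _ (norm_nonneg _))
        · rw [Measure.real]
          exact ENNReal.toReal_le_of_le_ofReal hM.le hSM
    _ = (2 * b + 1) * ρ := by
        have : M = ρ * ρ := (Real.mul_self_sqrt hM.le).symm
        rw [this]; field_simp

/-- indicator function -/
noncomputable def ind (S : Set E2) : E2 → ℝ := S.indicator (fun _ => 1)

lemma ind_int {S : Set E2} (hS : MeasurableSet S) (hf : volume S ≠ ⊤) : Integrable (ind S) :=
  (integrable_indicator_iff hS).2 (integrableOn_const hf)

lemma ind_mul {S : Set E2} (f : E2 → ℝ) (hS : MeasurableSet S) :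
    ∫ t, ind S t * f t = ∫ t in S, f t := by
  rw [← integral_indicator hS]
  congr 1; ext t
  unfold ind
  by_cases h : t ∈ S <;> simp [h]

lemma cv_ind {S : Set E2} (hS : MeasurableSet S) (k : E2 → ℝ) (x : E2) :
    cv (ind S) k x = ∫ t in S, k (x - t) := ind_mul _ hS

lemma cv_ind_zero {S : Set E2} (hS : MeasurableSet S) {k : E2 → ℝ} {R : ℝ}
    (hk : ∀ z, R < ‖z‖ → k z = 0) {x : E2} (hx : ∀ t ∈ S, R < ‖x - t‖) : cv (ind S) k x = 0 := by
  rw [cv_ind hS]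
  exact setIntegral_eq_zero_of_forall_eq_zero (fun t ht => hk _ (hx t ht))

lemma cv_ind_supp {S : Set E2} (hS : MeasurableSet S) {k : E2 → ℝ} {R ρ : ℝ}
    (hk : ∀ z, R < ‖z‖ → k z = 0) (hSρ : S ⊆ Metric.closedBall 0 ρ) {x : E2} (hx : ρ + R < ‖x‖) :
    cv (ind S) k x = 0 := by
  refine cv_ind_zero hS hk (fun t ht => ?_)
  have h1 : ‖t‖ ≤ ρ := by simpa using hSρ ht
  have h2 := norm_sub_norm_le x t
  linarith

lemma cvP_bd {S : Set E2} (hS : MeasurableSet S) {a : ℝ} (ha : 0 < a) (x : E2) :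
    0 ≤ cv (ind S) (P a) x ∧ cv (ind S) (P a) x ≤ ∫ z, P a z := by
  rw [cv_ind hS]
  have hi : Integrable (P a) := int_cs (P_contDiff a).continuous (P_cs ha)
  refine ⟨integral_nonneg (fun t => P_nonneg ha _), ?_⟩
  rw [← integral_sub_left_eq_self (P a) volume x]
  exact setIntegral_le_integral (hi.comp_sub_left x)
    (Filter.Eventually.of_forall fun t => P_nonneg ha _)

lemma cvP_int {S : Set E2} (hS : MeasurableSet S) (hf : volume S ≠ ⊤) {a : ℝ} (ha : 0 < a) :
    ∫ x, cv (ind S) (P a) x = volume.real S * ∫ z, P a z := by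
  have hi : Integrable (P a) := int_cs (P_contDiff a).continuous (P_cs ha)
  rw [cv_eq, integral_convolution _ (ind_int hS hf) hi]
  have : ∫ x, ind S x = volume.real S := by
    unfold ind; rw [integral_indicator hS]; simp
  rw [this]; rfl

lemma cvP_integrable {S : Set E2} (hS : MeasurableSet S) (hf : volume S ≠ ⊤) {a : ℝ} (ha : 0 < a) :
    Integrable (cv (ind S) (P a)) :=
  (ind_int hS hf).integrable_convolution (L := ContinuousLinearMap.mul ℝ ℝ)
    (int_cs (P_contDiff a).continuous (P_cs ha))

lemma cvP_sq {S : Set E2} (hS : MeasurableSet S) (hf : volume S ≠ ⊤) {a : ℝ} (ha : 0 < a) :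
    Integrable (fun x => cv (ind S) (P a) x ^ 2) ∧
    ∫ x, cv (ind S) (P a) x ^ 2 ≤ volume.real S * (∫ z, P a z) ^ 2 := by
  have h1 := cvP_integrable hS hf ha
  have h2 : ∀ x, cv (ind S) (P a) x ^ 2 ≤ (∫ z, P a z) * cv (ind S) (P a) x := by
    intro x
    obtain ⟨b1, b2⟩ := cvP_bd hS ha x
    nlinarith
  have hi : Integrable (fun x => cv (ind S) (P a) x ^ 2) := by
    refine (h1.const_mul (∫ z, P a z)).mono' ?_ (Filter.Eventually.of_forall fun x => ?_)
    · exact h1.aestronglyMeasurable.pow 2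
    · rw [Real.norm_of_nonneg (by positivity)]; exact h2 x
  refine ⟨hi, ?_⟩
  calc _ ≤ ∫ x, (∫ z, P a z) * cv (ind S) (P a) x := integral_mono hi (h1.const_mul _) h2
    _ = _ := by rw [integral_const_mul, cvP_int hS hf ha]; ring

noncomputable def tf (e a : ℝ) (S : Set E2) (x : E2) : ℝ × ℝ :=
  (cv (ind S) (k1 e a) x, cv (ind S) (k2 e a) x)

lemma tf_test {S : Set E2} (hS : IsCompact S) {e a R ρ : ℝ} (he : 0 < e) (ha : 0 < a)
    (hea : e ≤ a) (hR : 2 * a ≤ R ^ 2) (hR0 : 0 ≤ R) (hSρ : S ⊆ Metric.closedBall 0 ρ)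
    (hρ : ρ + R < 1) :
    IsTestField (tf e a S) ∧
    (∀ x, ρ + R < ‖x‖ → tf e a S x = 0) ∧
    (∀ x, divg (tf e a S) x = cv (ind S) (P e) x - cv (ind S) (P a) x) ∧
    h10norm (tf e a S) ≤ 2 * (∫ z, P a z) * Real.sqrt (volume.real S) := by
  have hm := hS.measurableSet
  have hf : volume S ≠ ⊤ := hS.measure_lt_top.ne
  have hi := ind_int hm hf
  have z1 : ∀ x, R < ‖x‖ → k1 e a x = 0 := fun x hx => k1_zero he ha hea hR hR0 hx
  have z2 : ∀ x, R < ‖x‖ → k2 e a x = 0 := fun x hx => k2_zero he ha hea hR hR0 hx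
  have cu := cv_contDiff hi (k1_contDiff e a) (hcs z1)
  have cw := cv_contDiff hi (k2_contDiff e a) (hcs z2)
  have du := fun x => cv_fderiv hi (k1_contDiff e a) (hcs z1) x
  have dw := fun x => cv_fderiv hi (k2_contDiff e a) (hcs z2) x
  have su : ∀ x, ρ + R < ‖x‖ → cv (ind S) (k1 e a) x = 0 := fun x hx => cv_ind_supp hm z1 hSρ hx
  have sw : ∀ x, ρ + R < ‖x‖ → cv (ind S) (k2 e a) x = 0 := fun x hx => cv_ind_supp hm z2 hSρ hx
  have s0 : ∀ x, ρ + R < ‖x‖ → tf e a S x = 0 := by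
    intro x hx; unfold tf; rw [su x hx, sw x hx]; rfl
  have hdiv : ∀ x, fderiv ℝ (cv (ind S) (k1 e a)) x (1, 0) +
      fderiv ℝ (cv (ind S) (k2 e a)) x (0, 1) = cv (ind S) (P e) x - cv (ind S) (P a) x := by
    intro x
    rw [du, dw, ← cv_sub hi (P_contDiff e).continuous (P_cs he) (P_contDiff a).continuous (P_cs ha),
      ← cv_add hi (cd_fderiv (k1_contDiff e a) _).continuous ((hcs z1).fderiv_apply ℝ _)
      (cd_fderiv (k2_contDiff e a) _).continuous ((hcs z2).fderiv_apply ℝ _)]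
    simp only [k_div he ha]
  refine ⟨⟨cu.prodMk cw, ?_, ?_⟩, s0, ?_, ?_⟩
  · exact HasCompactSupport.intro (isCompact_closedBall (0 : E2) (ρ + R))
      (fun x hx => s0 x (by simpa using hx))
  · have : tsupport (tf e a S) ⊆ Metric.closedBall 0 (ρ + R) := by
      apply closure_minimal _ Metric.isClosed_closedBall
      intro x hx
      by_contra h
      exact hx (s0 x (by simpa using h))
    exact this.trans (Metric.closedBall_subset_ball hρ)
  · intro x
    unfold divg tf
    rw [prod_fderiv cu cw, prod_fderiv cu cw]
    exact hdiv x
  · refine (h10_le cu (hcs su) cw (hcs sw) ?_).trans ?_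
    · intro x; rw [du, dw]; simp only [k_curl]
    · simp only [hdiv]
      obtain ⟨i1, b1⟩ := cvP_sq hm hf he
      obtain ⟨i2, b2⟩ := cvP_sq hm hf ha
      rw [P_int he ha hea] at b1
      have hκ := (P_int_pos ha).le
      apply Real.sqrt_le_iff.2
      refine ⟨by positivity, ?_⟩
      rw [mul_pow, Real.sq_sqrt measureReal_nonneg]
      calc ∫ x, (cv (ind S) (P e) x - cv (ind S) (P a) x) ^ 2
          ≤ ∫ x, (2 * cv (ind S) (P e) x ^ 2 + 2 * cv (ind S) (P a) x ^ 2) := by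
            apply integral_mono_of_nonneg
            · exact Filter.Eventually.of_forall fun x => by positivity
            · exact (i1.const_mul 2).add (i2.const_mul 2)
            · refine Filter.Eventually.of_forall fun x => ?_
              simp only
              nlinarith [sq_nonneg (cv (ind S) (P e) x + cv (ind S) (P a) x)]
        _ = 2 * (∫ x, cv (ind S) (P e) x ^ 2) + 2 * ∫ x, cv (ind S) (P a) x ^ 2 := by
            rw [integral_add (i1.const_mul 2) (i2.const_mul 2), integral_const_mul,
              integral_const_mul]
        _ ≤ _ := by nlinarith

lemma tf_bd {C0 : ℝ} {S : Set E2} {M : ℝ} (hm : MeasurableSet S)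
    (hC : ∀ x : E2, IntegrableOn (fun t => ‖x - t‖⁻¹) S ∧
      ∫ t in S, ‖x - t‖⁻¹ ≤ C0 * Real.sqrt M) {e a : ℝ} (he : 0 < e) (ha : 0 < a) (x : E2) :
    |(tf e a S x).1| ≤ C0 * Real.sqrt M ∧ |(tf e a S x).2| ≤ C0 * Real.sqrt M := by
  unfold tf
  simp only [cv_ind hm]
  constructor
  · refine (norm_integral_le_of_norm_le (f := fun t => k1 e a (x - t)) (hC x).1
      (Filter.Eventually.of_forall fun t => ?_)).trans (hC x).2
    exact k1_abs he ha _
  · refine (norm_integral_le_of_norm_le (f := fun t => k2 e a (x - t)) (hC x).1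
      (Filter.Eventually.of_forall fun t => ?_)).trans (hC x).2
    exact k2_abs he ha _

lemma cv_on {K : Set E2} {δ : ℝ} (hδ : 0 < δ) {x : E2} (hx : x ∈ K) :
    cv (ind (Metric.cthickening δ K)) (P (δ ^ 2 / 2)) x = ∫ z, P (δ ^ 2 / 2) z := by
  have hm : MeasurableSet (Metric.cthickening δ K) := Metric.isClosed_cthickening.measurableSet
  rw [cv_ind hm, ← integral_sub_left_eq_self (P (δ ^ 2 / 2)) volume x]
  apply setIntegral_eq_integral_of_forall_compl_eq_zero
  intro t ht
  apply P_zero (R := δ) (by positivity) (by linarith) hδ.le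
  by_contra h
  apply ht
  apply Metric.mem_cthickening_of_dist_le t x δ K hx
  rw [dist_comm, dist_eq_norm]; exact not_lt.1 h

lemma cv_off {K : Set E2} (hK : IsCompact K) {δ ε : ℝ} (hδ : 0 < δ) {x : E2}
    (hx : ∀ z ∈ K, ε ≤ dist x z) (hε : 2 * δ < ε) :
    cv (ind (Metric.cthickening δ K)) (P (δ ^ 2 / 2)) x = 0 := by
  have hm : MeasurableSet (Metric.cthickening δ K) := Metric.isClosed_cthickening.measurableSet
  apply cv_ind_zero hm (R := δ)
  · intro z hz; exact P_zero (R := δ) (by positivity) (by linarith) hδ.le hz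
  · intro t ht
    rw [hK.cthickening_eq_biUnion_closedBall hδ.le] at ht
    simp only [Set.mem_iUnion, Metric.mem_closedBall] at ht
    obtain ⟨z, hz, htz⟩ := ht
    have h1 := hx z hz
    have h2 := dist_triangle x t z
    rw [← dist_eq_norm]; linarith

lemma cv_lim {K : Set E2} (hK : IsCompact K) {δ : ℕ → ℝ} (hδ : ∀ n, 0 < δ n)
    (hδ0 : Filter.Tendsto δ Filter.atTop (nhds 0)) {κ : ℝ}
    (hκ : ∀ n, ∫ z, P (δ n ^ 2 / 2) z = κ) {V1 : E2 → ℝ} (hV : Integrable V1) :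
    Filter.Tendsto (fun n => ∫ x, V1 x * cv (ind (Metric.cthickening (δ n) K)) (P (δ n ^ 2 / 2)) x)
      Filter.atTop (nhds (κ * ∫ x in K, V1 x)) := by
  have hKm := hK.measurableSet
  have : κ * ∫ x in K, V1 x = ∫ x, V1 x * (κ * ind K x) := by
    rw [← ind_mul _ hKm, ← integral_const_mul]
    congr 1; ext x; ring
  rw [this]
  apply tendsto_integral_of_dominated_convergence (fun x => ‖V1 x‖ * κ)
  · intro n
    refine hV.aestronglyMeasurable.mul ?_
    have hc : IsCompact (Metric.cthickening (δ n) K) := hK.cthickening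
    exact (cv_contDiff (ind_int hc.measurableSet hc.measure_lt_top.ne) (P_contDiff _)
      (P_cs (by have := hδ n; positivity))).continuous.aestronglyMeasurable
  · exact hV.norm.mul_const κ
  · intro n
    refine Filter.Eventually.of_forall fun x => ?_
    rw [norm_mul]
    have hc : IsCompact (Metric.cthickening (δ n) K) := hK.cthickening
    obtain ⟨b1, b2⟩ := cvP_bd hc.measurableSet (a := δ n ^ 2 / 2) (by have := hδ n; positivity) x
    rw [hκ n] at b2
    rw [Real.norm_of_nonneg b1]
    gcongr
  · refine Filter.Eventually.of_forall fun x => ?_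
    apply Filter.Tendsto.const_mul
    by_cases hx : x ∈ K
    · have : ind K x = 1 := Set.indicator_of_mem hx _
      rw [this, mul_one]
      apply tendsto_const_nhds.congr
      intro n
      rw [cv_on (hδ n) hx, hκ n]
    · have : ind K x = 0 := Set.indicator_of_notMem hx _
      rw [this, mul_zero]
      obtain ⟨ε, hε, hb⟩ := Metric.isOpen_iff.1 hK.isClosed.isOpen_compl x hx
      have hev : ∀ᶠ n in Filter.atTop, δ n < ε / 2 :=
        hδ0.eventually (gt_mem_nhds (by positivity))
      apply tendsto_const_nhds.congr'
      filter_upwards [hev] with n hn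
      rw [cv_off hK (hδ n) (ε := ε) _ (by linarith)]
      intro z hz
      by_contra h
      exact hb (show z ∈ Metric.ball x ε by rw [Metric.mem_ball, dist_comm]; exact not_le.1 h) hz

lemma divg_zero {φ : E2 → ℝ × ℝ} {ρ : ℝ} (h : ∀ x, ρ < ‖x‖ → φ x = 0) {x : E2} (hx : ρ < ‖x‖) :
    divg φ x = 0 := by
  have : φ =ᶠ[nhds x] fun _ => 0 := by
    have ho : IsOpen {z : E2 | ρ < ‖z‖} := isOpen_lt continuous_const continuous_norm
    filter_upwards [ho.mem_nhds hx] with z hz using h z hz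
  unfold divg
  rw [this.fderiv_eq]; simp

/-- The hypotheses of the theorem, packaged. -/
structure Hyp (V : E2 → ℝ) (A : (E2 → ℝ × ℝ) →ₗ[ℝ] ℝ) (B : E2 → ℝ × ℝ) (nA : ℝ) : Prop where
  n0 : 0 ≤ nA
  li : LocallyIntegrableOn V (Metric.ball (0 : E2) 1)
  iB : IntegrableOn B (Metric.ball (0 : E2) 1)
  hA : ∀ φ : E2 → ℝ × ℝ, IsTestField φ → |A φ| ≤ nA * h10norm φ
  eq : ∀ φ : E2 → ℝ × ℝ, IsTestField φ → -∫ x, V x * divg φ x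
            = A φ + ∫ x, ((B x).1 * (φ x).1 + (B x).2 * (φ x).2)

noncomputable def V1 (V : E2 → ℝ) (ρ : ℝ) : E2 → ℝ := (Metric.closedBall (0 : E2) ρ).indicator V

lemma V1_int {V A B nA} (h : Hyp V A B nA) {ρ : ℝ} (hρ : ρ < 1) : Integrable (V1 V ρ) := by
  unfold V1
  rw [integrable_indicator_iff Metric.isClosed_closedBall.measurableSet]
  exact h.li.integrableOn_compact_subset (Metric.closedBall_subset_ball hρ)
    (isCompact_closedBall _ _)

lemma key {V A B nA} (h : Hyp V A B nA) {ρ b : ℝ} (hb : 0 ≤ b) {φ : E2 → ℝ × ℝ}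
    (hφ : IsTestField φ) (hz : ∀ x, ρ < ‖x‖ → φ x = 0)
    (hφ1 : ∀ x, |(φ x).1| ≤ b ∧ |(φ x).2| ≤ b) :
    |∫ x, V1 V ρ x * divg φ x| ≤ nA * h10norm φ +
      2 * b * ∫ x in Metric.ball (0 : E2) 1, ‖B x‖ := by
  have e1 : ∫ x, V1 V ρ x * divg φ x = ∫ x, V x * divg φ x := by
    congr 1; ext x
    by_cases hx : ρ < ‖x‖
    · rw [divg_zero hz hx, mul_zero, mul_zero]
    · unfold V1; rw [Set.indicator_of_mem (by simpa using hx)]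
  have h1 := h.eq φ hφ
  have h2 := h.hA φ hφ
  have hm : MeasurableSet (Metric.ball (0 : E2) 1) := Metric.isOpen_ball.measurableSet
  have h3 : ‖∫ x, ((B x).1 * (φ x).1 + (B x).2 * (φ x).2)‖ ≤
      ∫ x, (Metric.ball (0 : E2) 1).indicator (fun x => 2 * b * ‖B x‖) x := by
    apply norm_integral_le_of_norm_le
    · rw [integrable_indicator_iff hm]; exact h.iB.norm.const_mul _
    · refine Filter.Eventually.of_forall fun x => ?_
      by_cases hx : x ∈ Metric.ball (0 : E2) 1
      · rw [Set.indicator_of_mem hx]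
        have b1 : |(B x).1| ≤ ‖B x‖ := norm_fst_le (B x)
        have b2 : |(B x).2| ≤ ‖B x‖ := norm_snd_le (B x)
        obtain ⟨c1, c2⟩ := hφ1 x
        calc ‖(B x).1 * (φ x).1 + (B x).2 * (φ x).2‖
            ≤ |(B x).1| * |(φ x).1| + |(B x).2| * |(φ x).2| := by
              rw [← abs_mul, ← abs_mul]; exact abs_add_le _ _
          _ ≤ ‖B x‖ * b + ‖B x‖ * b := by gcongr
          _ = _ := by ring
      · rw [Set.indicator_of_notMem hx]
        have : φ x = 0 := by
          by_contra hne
          exact hx (hφ.2.2 (subset_tsupport _ hne))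
        rw [this]; simp
  rw [integral_indicator hm, integral_const_mul, Real.norm_eq_abs] at h3
  rw [e1, ← abs_neg, h1]
  exact (abs_add_le _ _).trans (add_le_add h2 h3)

lemma P_even (a : ℝ) (x y : E2) : P a (x - y) = P a (y - x) := by
  have : sq (x - y) = sq (y - x) := by unfold sq; simp; ring
  unfold P; rw [this]

/-- The Fubini step. -/
lemma fub {V1 : E2 → ℝ} (hV : Integrable V1) {S : Set E2} (hS : IsCompact S) {a : ℝ} (ha : 0 < a) :
    ∫ x, V1 x * cv (ind S) (P a) x = ∫ t in S, cv V1 (P a) t := by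
  have hm := hS.measurableSet
  have hi := ind_int hm hS.measure_lt_top.ne
  rw [← ind_mul _ hm]
  unfold cv
  simp only [← integral_const_mul]
  rw [integral_integral_swap]
  · congr 1; ext t; congr 1; ext x; rw [P_even]; ring
  · have hp : Integrable (fun p : E2 × E2 => V1 p.1 * ind S p.2) (volume.prod volume) :=
      hV.mul_prod hi
    obtain ⟨C, hC⟩ := (P_cs ha).exists_bound_of_continuous (P_contDiff a).continuous
    have := hp.mul_bdd (c := C) (g := fun p : E2 × E2 => P a (p.1 - p.2))
      (by have := (P_contDiff a).continuous; fun_prop) (Filter.Eventually.of_forall fun t => hC _)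
    refine this.congr (Filter.Eventually.of_forall fun p => ?_)
    simp [Function.uncurry]; ring

lemma U_lip {a R ρ1 : ℝ} (ha : 0 < a) (hR : 2 * a ≤ R ^ 2) (hR0 : 0 ≤ R) (hρ0 : 0 ≤ ρ1)
    (hρ : ρ1 + R < 1) : ∃ CU : ℝ, 0 ≤ CU ∧
    ∀ {V A B nA}, Hyp V A B nA → ∀ y ∈ Metric.closedBall (0 : E2) ρ1,
      |cv (V1 V (ρ1 + R)) (P a) y - cv (V1 V (ρ1 + R)) (P a) 0| ≤
        CU * (nA + ∫ x in Metric.ball (0 : E2) 1, ‖B x‖) := by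
  obtain ⟨sP, hsP⟩ := (P_cs ha).exists_bound_of_continuous (P_contDiff a).continuous
  have hsP0 : 0 ≤ sP := (norm_nonneg _).trans (hsP 0)
  set H := Real.sqrt (∫ z, (‖fderiv ℝ (P a) z (1, 0)‖ ^ 2 + ‖fderiv ℝ (P a) z (0, 1)‖ ^ 2)) with hH
  have hH0 : 0 ≤ H := Real.sqrt_nonneg _
  refine ⟨2 * (H + 2 * sP), by positivity, ?_⟩
  intro V A B nA h y hy
  set ρ := ρ1 + R with hρdef
  set N := nA + ∫ x in Metric.ball (0 : E2) 1, ‖B x‖ with hN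
  have hB0 : 0 ≤ ∫ x in Metric.ball (0 : E2) 1, ‖B x‖ := integral_nonneg fun x => norm_nonneg _
  have hN0 : 0 ≤ N := add_nonneg h.n0 hB0
  have hV := V1_int h hρ
  have hPd : Differentiable ℝ (P a) := (P_contDiff a).differentiable (by simp)
  -- derivative of reflected-translated bump
  have hq : ∀ y x v : E2, fderiv ℝ (fun x => P a (y - x)) x v = - fderiv ℝ (P a) (y - x) v := by
    intro y x v
    have h1 : HasFDerivAt (fun x : E2 => y - x) (-(ContinuousLinearMap.id ℝ E2)) x :=
      (hasFDerivAt_id x).const_sub y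
    have h2 := (hPd (y - x)).hasFDerivAt.comp x h1
    have h3 : fderiv ℝ (fun x => P a (y - x)) x = _ := h2.fderiv
    rw [h3]; simp
  have hqc : ∀ y : E2, ContDiff ℝ (⊤ : ℕ∞) (fun x => P a (y - x)) := fun y =>
    (P_contDiff a).comp (contDiff_const.sub contDiff_id)
  have hc0 : ContDiff ℝ (⊤ : ℕ∞) (fun _ : E2 => (0:ℝ)) := contDiff_const
  have hz : ∀ y ∈ Metric.closedBall (0 : E2) ρ1, ∀ x : E2, ρ < ‖x‖ → P a (y - x) = 0 := by
    intro y hy x hx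
    apply P_zero ha hR hR0
    have h1 : ‖y‖ ≤ ρ1 := by simpa using hy
    have h2 := norm_sub_norm_le x y
    rw [norm_sub_rev]; linarith
  have hit : ∀ (y : E2) (v : E2 × E2), ∫ x, (‖fderiv ℝ (P a) (y - x) (1, 0)‖ ^ 2 +
      ‖fderiv ℝ (P a) (y - x) (0, 1)‖ ^ 2) =
      ∫ z, (‖fderiv ℝ (P a) z (1, 0)‖ ^ 2 + ‖fderiv ℝ (P a) z (0, 1)‖ ^ 2) := fun y _ =>
    integral_sub_left_eq_self (fun z => ‖fderiv ℝ (P a) z (1, 0)‖ ^ 2 +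
      ‖fderiv ℝ (P a) z (0, 1)‖ ^ 2) volume y
  have sub : ∀ φ : E2 → ℝ × ℝ, (∀ x, ρ < ‖x‖ → φ x = 0) → HasCompactSupport φ ∧
      tsupport φ ⊆ Metric.ball (0 : E2) 1 := by
    intro φ s0
    refine ⟨HasCompactSupport.intro (isCompact_closedBall (0 : E2) ρ)
      (fun x hx => s0 x (by simpa using hx)), ?_⟩
    have : tsupport φ ⊆ Metric.closedBall 0 ρ := by
      apply closure_minimal _ Metric.isClosed_closedBall
      intro x hx
      by_contra h
      exact hx (s0 x (by simpa using h))
    exact this.trans (Metric.closedBall_subset_ball hρ)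
  have fin : nA * H + 2 * sP * ∫ x in Metric.ball (0 : E2) 1, ‖B x‖ ≤ (H + 2 * sP) * N := by
    rw [hN]; nlinarith [mul_nonneg hH0 hB0, mul_nonneg hsP0 h.n0]
  have d1 : ∀ y ∈ Metric.closedBall (0 : E2) ρ1,
      |fderiv ℝ (cv (V1 V ρ) (P a)) y (1, 0)| ≤ (H + 2 * sP) * N := by
    intro y hy
    rw [cv_fderiv hV (P_contDiff a) (P_cs ha)]
    have s0 : ∀ x, ρ < ‖x‖ → (fun x => (P a (y - x), (0:ℝ))) x = 0 := by
      intro x hx; simp only [hz y hy x hx]; rfl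
    have := key h (ρ := ρ) (b := sP) hsP0 (φ := fun x => (P a (y - x), (0:ℝ)))
      ⟨(hqc y).prodMk hc0, (sub _ s0).1, (sub _ s0).2⟩ s0
      (fun x => ⟨hsP _, by simpa using hsP0⟩)
    have hh : h10norm (fun x => (P a (y - x), (0:ℝ))) = H := by
      unfold h10norm
      simp only [prod_fderiv (hqc y) hc0, hq]
      rw [hH, ← hit y 0]
      simp [Prod.norm_def]
    rw [hh] at this
    refine le_trans (le_of_eq ?_) (this.trans fin)
    unfold cv divg
    simp only [prod_fderiv (hqc y) hc0, hq]
    rw [← abs_neg, ← integral_neg]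
    simp
  have d2 : ∀ y ∈ Metric.closedBall (0 : E2) ρ1,
      |fderiv ℝ (cv (V1 V ρ) (P a)) y (0, 1)| ≤ (H + 2 * sP) * N := by
    intro y hy
    rw [cv_fderiv hV (P_contDiff a) (P_cs ha)]
    have s0 : ∀ x, ρ < ‖x‖ → (fun x => ((0:ℝ), P a (y - x))) x = 0 := by
      intro x hx; simp only [hz y hy x hx]; rfl
    have := key h (ρ := ρ) (b := sP) hsP0 (φ := fun x => ((0:ℝ), P a (y - x)))
      ⟨hc0.prodMk (hqc y), (sub _ s0).1, (sub _ s0).2⟩ s0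
      (fun x => ⟨by simpa using hsP0, hsP _⟩)
    have hh : h10norm (fun x => ((0:ℝ), P a (y - x))) = H := by
      unfold h10norm
      simp only [prod_fderiv hc0 (hqc y), hq]
      rw [hH, ← hit y 0]
      simp [Prod.norm_def]
    rw [hh] at this
    refine le_trans (le_of_eq ?_) (this.trans fin)
    unfold cv divg
    simp only [prod_fderiv hc0 (hqc y), hq]
    rw [← abs_neg, ← integral_neg]
    simp
  have dn : ∀ y ∈ Metric.closedBall (0 : E2) ρ1,
      ‖fderiv ℝ (cv (V1 V ρ) (P a)) y‖ ≤ 2 * (H + 2 * sP) * N := by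
    intro y hy
    apply ContinuousLinearMap.opNorm_le_bound _ (by positivity)
    intro v
    have hv : v = v.1 • ((1:ℝ), (0:ℝ)) + v.2 • ((0:ℝ), (1:ℝ)) := by ext <;> simp
    have b1 : |v.1| ≤ ‖v‖ := norm_fst_le v
    have b2 : |v.2| ≤ ‖v‖ := norm_snd_le v
    conv_lhs => rw [hv, map_add, map_smul, map_smul]
    refine (norm_add_le _ _).trans ?_
    rw [norm_smul, norm_smul]
    have := d1 y hy
    have := d2 y hy
    calc ‖v.1‖ * ‖fderiv ℝ (cv (V1 V ρ) (P a)) y (1, 0)‖ +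
        ‖v.2‖ * ‖fderiv ℝ (cv (V1 V ρ) (P a)) y (0, 1)‖
        ≤ ‖v‖ * ((H + 2 * sP) * N) + ‖v‖ * ((H + 2 * sP) * N) := by
          gcongr
          · exact b1
          · exact d1 y hy
          · exact b2
          · exact d2 y hy
      _ = _ := by ring
  have hcd := cv_contDiff hV (P_contDiff a) (P_cs ha)
  have mv := Convex.norm_image_sub_le_of_norm_hasFDerivWithin_le (𝕜 := ℝ)
    (f := cv (V1 V ρ) (P a)) (s := Metric.closedBall (0 : E2) ρ1) (x := 0) (y := y)
    (fun x _ => ((hcd.differentiable (by simp)) x).hasFDerivAt.hasFDerivWithinAt) dn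
    (convex_closedBall _ _) (by simpa using hρ0) hy
  rw [sub_zero] at mv
  refine mv.trans ?_
  have h1 : ‖y‖ ≤ 1 := by
    have : ‖y‖ ≤ ρ1 := by simpa using hy
    linarith
  have : 0 ≤ 2 * (H + 2 * sP) * N := by positivity
  nlinarith


lemma est {a R ρ1 C0 CU : ℝ} (ha : 0 < a) (hR : 2 * a ≤ R ^ 2) (hR0 : 0 ≤ R)
    (hρ : ρ1 + R < 1) (hC0 : 0 < C0)
    (hC : ∀ (S : Set E2) (M : ℝ), MeasurableSet S → 0 < M → volume S ≤ ENNReal.ofReal M →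
      ∀ x : E2, IntegrableOn (fun t => ‖x - t‖⁻¹) S ∧ ∫ t in S, ‖x - t‖⁻¹ ≤ C0 * Real.sqrt M)
    {V A B nA} (h : Hyp V A B nA)
    (hU : ∀ y ∈ Metric.closedBall (0 : E2) ρ1,
      |cv (V1 V (ρ1 + R)) (P a) y - cv (V1 V (ρ1 + R)) (P a) 0| ≤
        CU * (nA + ∫ x in Metric.ball (0 : E2) 1, ‖B x‖))
    {S : Set E2} (hS : IsCompact S) (hSρ : S ⊆ Metric.closedBall 0 ρ1) {M : ℝ} (hM : 0 < M)
    (hSM : volume S ≤ ENNReal.ofReal M) {e : ℝ} (he : 0 < e) (hea : e ≤ a) :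
    |(∫ x, V1 V (ρ1 + R) x * cv (ind S) (P e) x) - cv (V1 V (ρ1 + R)) (P a) 0 * volume.real S| ≤
      (2 * (∫ z, P a z) + 2 * C0) * Real.sqrt M * (nA + ∫ x in Metric.ball (0 : E2) 1, ‖B x‖)
      + CU * (nA + ∫ x in Metric.ball (0 : E2) 1, ‖B x‖) * volume.real S := by
  have hm := hS.measurableSet
  have hf : volume S ≠ ⊤ := hS.measure_lt_top.ne
  have hV := V1_int h hρ
  obtain ⟨t1, t2, t3, t4⟩ := tf_test hS he ha hea hR hR0 hSρ hρ
  have hκ := (P_int_pos ha).le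
  set κ := ∫ z, P a z
  set b := ∫ x in Metric.ball (0 : E2) 1, ‖B x‖ with hb
  have hb0 : 0 ≤ b := integral_nonneg fun _ => norm_nonneg _
  have hn := h.n0
  have hSM' : volume.real S ≤ M := ENNReal.toReal_le_of_le_ofReal hM.le hSM
  have k := key h (by positivity : 0 ≤ C0 * Real.sqrt M) t1 t2
    (fun x => tf_bd hm (hC S M hm hM hSM) he ha x)
  have i1 : ∀ {a' : ℝ}, 0 < a' → Integrable (fun x => V1 V (ρ1 + R) x * cv (ind S) (P a') x) := by
    intro a' ha'
    have hcd := cv_contDiff (ind_int hm hf) (P_contDiff a') (P_cs ha')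
    obtain ⟨Cc, hCc⟩ := (P_cs ha').exists_bound_of_continuous (P_contDiff a').continuous
    refine hV.mul_bdd (c := ∫ z, P a' z) hcd.continuous.aestronglyMeasurable
      (Filter.Eventually.of_forall fun x => ?_)
    have := cvP_bd (S := S) hm ha' x
    rw [Real.norm_eq_abs, abs_of_nonneg this.1]; exact this.2
  have k2 : |(∫ x, V1 V (ρ1 + R) x * cv (ind S) (P e) x) -
      ∫ x, V1 V (ρ1 + R) x * cv (ind S) (P a) x| ≤ (2 * κ + 2 * C0) * Real.sqrt M * (nA + b) := by
    rw [← integral_sub (i1 he) (i1 ha)]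
    have : ∀ x, V1 V (ρ1 + R) x * cv (ind S) (P e) x - V1 V (ρ1 + R) x * cv (ind S) (P a) x
      = V1 V (ρ1 + R) x * divg (tf e a S) x := fun x => by rw [t3]; ring
    simp only [this]
    refine k.trans ?_
    have hs : Real.sqrt (volume.real S) ≤ Real.sqrt M := Real.sqrt_le_sqrt hSM'
    calc nA * h10norm (tf e a S) + 2 * (C0 * √M) * b
        ≤ nA * (2 * κ * √M) + 2 * (C0 * √M) * b := by
          gcongr
          exact t4.trans (by gcongr)
      _ ≤ _ := by
          have : 0 ≤ κ * √M * b := by positivity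
          have : 0 ≤ C0 * √M * nA := by positivity
          nlinarith
  have k3 : |(∫ x, V1 V (ρ1 + R) x * cv (ind S) (P a) x) -
      cv (V1 V (ρ1 + R)) (P a) 0 * volume.real S| ≤ CU * (nA + b) * volume.real S := by
    rw [fub hV hS ha]
    have hcd := cv_contDiff hV (P_contDiff a) (P_cs ha)
    have ic : IntegrableOn (cv (V1 V (ρ1 + R)) (P a)) S :=
      hcd.continuous.continuousOn.integrableOn_compact hS
    have : (∫ t in S, cv (V1 V (ρ1 + R)) (P a) t) - cv (V1 V (ρ1 + R)) (P a) 0 * volume.real S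
      = ∫ t in S, (cv (V1 V (ρ1 + R)) (P a) t - cv (V1 V (ρ1 + R)) (P a) 0) := by
      rw [integral_sub ic (integrableOn_const hf)]
      simp [mul_comm]
    rw [this, ← Real.norm_eq_abs]
    exact norm_setIntegral_le_of_norm_le_const hS.measure_lt_top
      (fun x hx => hU x (hSρ hx))
  have := abs_sub_le (∫ x, V1 V (ρ1 + R) x * cv (ind S) (P e) x)
    (∫ x, V1 V (ρ1 + R) x * cv (ind S) (P a) x) (cv (V1 V (ρ1 + R)) (P a) 0 * volume.real S)
  linarith

lemma cpt {r : ℝ} (hr0 : 0 < r) (hr1 : r < 1) : ∃ C2 : ℝ, 0 < C2 ∧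
    ∀ {V A B nA}, Hyp V A B nA → ∃ c : ℝ, ∀ K : Set E2, IsCompact K →
      K ⊆ Metric.closedBall 0 r →
      |∫ x in K, (V x - c)| ≤ C2 * Real.sqrt (volume.real K) *
        (nA + ∫ x in Metric.ball (0 : E2) 1, ‖B x‖) := by
  obtain ⟨C0, hC0, hC⟩ := sing
  obtain ⟨R, hRd⟩ : ∃ R, R = (1 - r) / 4 := ⟨_, rfl⟩
  have hR0 : 0 < R := by rw [hRd]; linarith
  obtain ⟨ρ1, hρd⟩ : ∃ ρ1, ρ1 = r + R := ⟨_, rfl⟩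
  have hρ : ρ1 + R < 1 := by rw [hρd]; linarith
  obtain ⟨a, had⟩ : ∃ a, a = R ^ 2 / 2 := ⟨_, rfl⟩
  have ha : 0 < a := by rw [had]; positivity
  have hR : 2 * a ≤ R ^ 2 := by rw [had]; linarith
  obtain ⟨CU, hCU0, hCU⟩ := U_lip ha hR hR0.le (by linarith : 0 ≤ ρ1) hρ
  have hκ := P_int_pos ha
  set κ := ∫ z, P a z with hκd
  set W := volume.real (Metric.closedBall (0 : E2) 1) with hW
  have hW0 : 0 ≤ W := measureReal_nonneg
  refine ⟨((2 * κ + 2 * C0) * 2 + CU * Real.sqrt W) / κ, by positivity, ?_⟩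
  intro V A B nA h
  have hV := V1_int h hρ
  set b := ∫ x in Metric.ball (0 : E2) 1, ‖B x‖ with hb
  have hb0 : 0 ≤ b := integral_nonneg fun _ => norm_nonneg _
  have hn := h.n0
  set U0 := cv (V1 V (ρ1 + R)) (P a) 0 with hU0
  refine ⟨U0 / κ, fun K hK hKr => ?_⟩
  have hKf : volume K ≠ ⊤ := hK.measure_lt_top.ne
  by_cases hK0 : volume K = 0
  · rw [setIntegral_measure_zero _ hK0, abs_zero]; positivity
  have hKp : 0 < volume.real K := ENNReal.toReal_pos hK0 hKf
  have hKW : volume.real K ≤ W := by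
    apply measureReal_mono _ (isCompact_closedBall _ _).measure_lt_top.ne
    exact hKr.trans (Metric.closedBall_subset_closedBall hr1.le)
  set δ : ℕ → ℝ := fun n => R / ((n : ℝ) + 1) with hδd
  have hδ : ∀ n, 0 < δ n := fun n => by simp only [hδd]; positivity
  have hδR : ∀ n, δ n ≤ R := fun n => by
    simp only [hδd]
    apply div_le_self hR0.le
    have : (0:ℝ) ≤ n := n.cast_nonneg
    linarith
  have hδ0 : Filter.Tendsto δ Filter.atTop (nhds 0) := by
    have := (tendsto_one_div_add_atTop_nhds_zero_nat (𝕜 := ℝ)).const_mul R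
    simpa [hδd, div_eq_mul_inv] using this
  have hea : ∀ n, δ n ^ 2 / 2 ≤ a := fun n => by
    rw [had]; have := hδR n; have := hδ n; gcongr
  have hep : ∀ n, 0 < δ n ^ 2 / 2 := fun n => by have := hδ n; positivity
  have L1 := cv_lim hK hδ hδ0 (fun n => P_int (hep n) ha (hea n)) hV
  have L2 : Filter.Tendsto (fun n => volume (Metric.cthickening (δ n) K)) Filter.atTop
      (nhds (volume K)) := (tendsto_measure_cthickening_of_isCompact hK).comp hδ0
  have L3 : Filter.Tendsto (fun n => volume.real (Metric.cthickening (δ n) K)) Filter.atTop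
      (nhds (volume.real K)) := (ENNReal.tendsto_toReal hKf).comp L2
  have hM : 0 < 2 * volume.real K := by linarith
  have ev : ∀ᶠ n in Filter.atTop, volume (Metric.cthickening (δ n) K) ≤
      ENNReal.ofReal (2 * volume.real K) := by
    have : volume K < ENNReal.ofReal (2 * volume.real K) := by
      rw [ENNReal.lt_ofReal_iff_toReal_lt hKf]
      change volume.real K < _
      linarith
    filter_upwards [L2.eventually_lt_const this] with n hn using hn.le
  have lim := le_of_tendsto_of_tendsto ((L1.sub (L3.const_mul U0)).abs)
    ((L3.const_mul (CU * (nA + b))).const_add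
      ((2 * κ + 2 * C0) * Real.sqrt (2 * volume.real K) * (nA + b))) (by
      filter_upwards [ev] with n hn'
      refine est ha hR hR0.le hρ hC0 hC h (hCU h) (hK.cthickening) ?_ hM hn' (hep n) (hea n)
      intro x hx
      rw [hK.cthickening_eq_biUnion_closedBall (hδ n).le] at hx
      simp only [Set.mem_iUnion] at hx
      obtain ⟨y, hy, hxy⟩ := hx
      have h1 := hKr hy
      simp only [Metric.mem_closedBall] at h1 hxy ⊢
      have := dist_triangle x y 0
      have := hδR n
      linarith)
  have eV : ∫ x in K, V1 V (ρ1 + R) x = ∫ x in K, V x := by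
    refine setIntegral_congr_fun hK.measurableSet fun x hx => ?_
    have : x ∈ Metric.closedBall (0 : E2) (ρ1 + R) :=
      Metric.closedBall_subset_closedBall (by linarith) (hKr hx)
    simp [V1, this]
  have iV : IntegrableOn V K := h.li.integrableOn_compact_subset
    (hKr.trans (Metric.closedBall_subset_ball hr1)) hK
  have eq : ∫ x in K, (V x - U0 / κ) =
      (κ * (∫ x in K, V1 V (ρ1 + R) x) - U0 * volume.real K) / κ := by
    rw [integral_sub iV (integrableOn_const hKf), eV]
    simp only [integral_const, smul_eq_mul, measureReal_restrict_apply_univ]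
    field_simp
  rw [eq, abs_div, abs_of_pos hκ, div_mul_eq_mul_div, div_mul_eq_mul_div]
  apply div_le_div_of_nonneg_right _ hκ.le
  refine lim.trans ?_
  have s1 : Real.sqrt (2 * volume.real K) ≤ 2 * Real.sqrt (volume.real K) := by
    apply Real.sqrt_le_iff.2
    refine ⟨by positivity, ?_⟩
    rw [mul_pow, Real.sq_sqrt hKp.le]; linarith
  have s2 : volume.real K ≤ Real.sqrt W * Real.sqrt (volume.real K) := by
    calc volume.real K = Real.sqrt (volume.real K) * Real.sqrt (volume.real K) :=
          (Real.mul_self_sqrt hKp.le).symm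
      _ ≤ _ := by gcongr
  calc _ ≤ (2 * κ + 2 * C0) * (2 * Real.sqrt (volume.real K)) * (nA + b) +
        CU * (nA + b) * (Real.sqrt W * Real.sqrt (volume.real K)) := by gcongr
    _ = _ := by ring

lemma half {r C2 N t : ℝ} {f : E2 → ℝ} (hC : 0 ≤ C2) (hN : 0 ≤ N) (ht : 0 < t)
    (hf : IntegrableOn f (Metric.closedBall 0 r))
    (hK : ∀ K : Set E2, IsCompact K → K ⊆ Metric.closedBall 0 r →
      |∫ x in K, f x| ≤ C2 * Real.sqrt (volume.real K) * N) :
    volume {x : E2 | x ∈ Metric.ball (0 : E2) r ∧ t < f x} ≤ ENNReal.ofReal ((C2 * N / t) ^ 2) := by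
  have hm : NullMeasurableSet {x : E2 | x ∈ Metric.ball (0 : E2) r ∧ t < f x} volume := by
    have hf' := hf.mono_set Metric.ball_subset_closedBall
    have h1 : AEMeasurable ((Metric.ball (0 : E2) r).indicator f) volume :=
      (hf'.integrable_indicator Metric.isOpen_ball.measurableSet).aemeasurable
    have h2 : {x : E2 | x ∈ Metric.ball (0 : E2) r ∧ t < f x} =
        {x | t < (Metric.ball (0 : E2) r).indicator f x} := by
      ext x
      by_cases hx : x ∈ Metric.ball (0 : E2) r
      · simp [Set.indicator_of_mem hx, -Metric.mem_ball, hx]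
      · simp [Set.indicator_of_notMem hx, -Metric.mem_ball, hx, ht.le]
    rw [h2]
    exact nullMeasurableSet_lt aemeasurable_const h1
  obtain ⟨T, hTs, hTm, hTe⟩ := hm.exists_measurable_subset_ae_eq
  rw [← measure_congr hTe]
  have hTb : T ⊆ Metric.closedBall 0 r := fun x hx => Metric.ball_subset_closedBall (hTs hx).1
  have hTf : volume T ≠ ⊤ :=
    ((measure_mono hTb).trans_lt (isCompact_closedBall _ _).measure_lt_top).ne
  by_contra hcon
  push Not at hcon
  obtain ⟨K, hKT, hKc, hKl⟩ := hTm.exists_lt_isCompact_of_ne_top hTf hcon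
  have hKf : volume K ≠ ⊤ := hKc.measure_lt_top.ne
  have h1 := hK K hKc (hKT.trans hTb)
  have h2 : t * volume.real K ≤ ∫ x in K, f x := by
    have : ∫ x in K, t ≤ ∫ x in K, f x := by
      refine setIntegral_mono_on (integrableOn_const hKf) (hf.mono_set (hKT.trans hTb))
        hKc.measurableSet fun x hx => (hTs (hKT hx)).2.le
    simpa [mul_comm] using this
  have h3 := h2.trans ((le_abs_self _).trans h1)
  have h4 : (C2 * N / t) ^ 2 < volume.real K := by
    rwa [ENNReal.ofReal_lt_iff_lt_toReal (by positivity) hKf] at hKl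
  have hp : 0 < volume.real K := lt_of_le_of_lt (by positivity) h4
  have hs := Real.sqrt_pos.2 hp
  have h5 : C2 * N / t < Real.sqrt (volume.real K) := Real.lt_sqrt_of_sq_lt h4
  rw [div_lt_iff₀ ht] at h5
  have h6 := Real.mul_self_sqrt hp.le
  nlinarith

end Aux18
theorem stmt18 (r : ℝ) (hr0 : 0 < r) (hr1 : r < 1) :
    ∃ C : ℝ, 0 < C ∧
      ∀ (V : ℝ × ℝ → ℝ) (A : ((ℝ × ℝ) → ℝ × ℝ) →ₗ[ℝ] ℝ)
        (B : ℝ × ℝ → ℝ × ℝ) (normA : ℝ),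
        0 ≤ normA →
        LocallyIntegrableOn V (Metric.ball (0 : ℝ × ℝ) 1) →
        IntegrableOn B (Metric.ball (0 : ℝ × ℝ) 1) →
        -- A ∈ H^{-1}(D, ℝ²): bounded by normA on the Dirichlet norm
        (∀ φ : ℝ × ℝ → ℝ × ℝ, IsTestField φ → |A φ| ≤ normA * h10norm φ) →
        -- distributional equation ∇V = A + B on D
        (∀ φ : ℝ × ℝ → ℝ × ℝ, IsTestField φ →
          -∫ x, V x * divg φ x
            = A φ + ∫ x, ((B x).1 * (φ x).1 + (B x).2 * (φ x).2)) →
        ∃ c : ℝ,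
          wnorm2 (fun x => V x - c) (Metric.ball (0 : ℝ × ℝ) r)
            ≤ ENNReal.ofReal
              (C * (normA + ∫ x in Metric.ball (0 : ℝ × ℝ) 1, ‖B x‖)) := by
  obtain ⟨C2, hC2, H⟩ := Aux18.cpt hr0 hr1
  refine ⟨2 * C2, by positivity, ?_⟩
  intro V A B normA h0 hli hiB hA heq
  have h : Aux18.Hyp V A B normA := ⟨h0, hli, hiB, hA, heq⟩
  obtain ⟨c, hc⟩ := H h
  refine ⟨c, ?_⟩
  have hb0 : 0 ≤ ∫ x in Metric.ball (0 : ℝ × ℝ) 1, ‖B x‖ := integral_nonneg fun _ => norm_nonneg _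
  set N := normA + ∫ x in Metric.ball (0 : ℝ × ℝ) 1, ‖B x‖ with hN
  have hN0 : 0 ≤ N := by positivity
  have iV : IntegrableOn V (Metric.closedBall 0 r) := h.li.integrableOn_compact_subset
    (Metric.closedBall_subset_ball hr1) (isCompact_closedBall _ _)
  have iVc : IntegrableOn (fun x => V x - c) (Metric.closedBall 0 r) :=
    iV.sub (integrableOn_const (isCompact_closedBall _ _).measure_lt_top.ne)
  unfold wnorm2
  refine iSup_le fun ⟨t, ht⟩ => ?_
  have p1 := Aux18.half hC2.le hN0 ht iVc hc
  have p2 := Aux18.half hC2.le hN0 ht iVc.neg (fun K hK hKr => by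
    have := hc K hK hKr
    simpa only [Pi.neg_apply, integral_neg, abs_neg] using this)
  have hsub : {x : ℝ × ℝ | x ∈ Metric.ball (0 : ℝ × ℝ) r ∧ t < |V x - c|} ⊆
      {x | x ∈ Metric.ball (0 : ℝ × ℝ) r ∧ t < V x - c} ∪
      {x | x ∈ Metric.ball (0 : ℝ × ℝ) r ∧ t < (-fun x => V x - c) x} := by
    rintro x ⟨hx, hx2⟩
    rcases lt_abs.1 hx2 with h | h
    · exact Or.inl ⟨hx, h⟩
    · exact Or.inr ⟨hx, h⟩
  have hq : 0 ≤ C2 * N / t := by positivity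
  have hv : volume {x : ℝ × ℝ | x ∈ Metric.ball (0 : ℝ × ℝ) r ∧ t < |V x - c|} ≤
      ENNReal.ofReal ((2 * (C2 * N / t)) ^ 2) := by
    refine (measure_mono hsub).trans ((measure_union_le _ _).trans ((add_le_add p1 p2).trans ?_))
    rw [← ENNReal.ofReal_add (by positivity) (by positivity)]
    apply ENNReal.ofReal_le_ofReal
    nlinarith [sq_nonneg (C2 * N / t)]
  calc _ ≤ ENNReal.ofReal t * (ENNReal.ofReal ((2 * (C2 * N / t)) ^ 2)) ^ (1 / 2 : ℝ) := by
        gcongr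
    _ = ENNReal.ofReal (2 * C2 * N) := by
        rw [ENNReal.ofReal_rpow_of_nonneg (by positivity) (by norm_num), ← Real.sqrt_eq_rpow,
          Real.sqrt_sq (by positivity), ← ENNReal.ofReal_mul ht.le]
        congr 1
        field_simp
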